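/- (Deterministic core of Theorem 3.2(b), critical case.) If ∫₀^∞ g(s) ds = 1, then 0 < ∫₀^∞ s·g(s) ds < ∞ and M(t) converges as t → ∞ to the finite limit (∫₀^∞ f(s) ds)·(∫₀^∞ r(s)² ds) / (∫₀^∞ s·g(s) ds). -/

import Mathlib

open MeasureTheory Filter Set

/-- Integration of `u ↦ ψ (t + u)` over `[-α, 0]` against a finite signed Borel
measure `ν`, realised via its Jordan decomposition:
`Gν α ν ψ t = ∫_{[-α,0]} ψ(t+u) ν(du)`. -/
noncomputable def Gν (α : ℝ) (ν : MeasureTheory.SignedMeasure ℝ) (ψ : ℝ → ℝ) (t : ℝ) : ℝ :=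
  (∫ u in Set.Icc (-α) 0, ψ (t + u) ∂ν.toJordanDecomposition.posPart) -
  (∫ u in Set.Icc (-α) 0, ψ (t + u) ∂ν.toJordanDecomposition.negPart)

/-- Data of a critical renewal equation on the line, all functions vanishing on the negatives. -/
structure Ren (g f y : ℝ → ℝ) (B c : ℝ) : Prop where
  hB : 0 < B
  hc : 0 < c
  gm : Measurable g
  fm : Measurable f
  ym : Measurable y
  g0 : ∀ t, 0 ≤ g t
  f0 : ∀ t, 0 ≤ f t
  y0 : ∀ t, 0 ≤ y t
  gn : ∀ t < 0, g t = 0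
  fn : ∀ t < 0, f t = 0
  yn : ∀ t < 0, y t = 0
  gb : ∀ t ≥ 0, g t ≤ B * Real.exp (-c * t)
  fb : ∀ t ≥ 0, f t ≤ B * Real.exp (-c * t)
  yb : ∀ T, ∃ K, ∀ t ≤ T, y t ≤ K
  eqn : ∀ t, y t = f t + ∫ s, g (t - s) * y s
  crit : ∫ s, g s = 1

lemma integrable_of_exp {h : ℝ → ℝ} {B c : ℝ} (hc : 0 < c) (hm : Measurable h)
    (hn : ∀ t < 0, h t = 0) (hb : ∀ t ≥ 0, |h t| ≤ B * Real.exp (-c * t)) : Integrable h := by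
  have h1 : IntegrableOn h (Ici 0) := by
    rw [integrableOn_Ici_iff_integrableOn_Ioi]
    refine Integrable.mono' ((exp_neg_integrableOn_Ioi 0 hc).const_mul B)
      hm.aestronglyMeasurable ?_
    refine (ae_restrict_iff' measurableSet_Ioi).2 (Eventually.of_forall fun t ht => ?_)
    exact hb t (le_of_lt ht)
  have : h = (Ici (0:ℝ)).indicator h := by
    ext t
    by_cases ht : t < 0
    · simp [indicator, hn t ht]
    · simp [indicator, not_lt.1 ht]
  rw [this, integrable_indicator_iff measurableSet_Ici]
  exact h1

lemma integrable_of_bdd {h : ℝ → ℝ} {K T : ℝ} (hm : Measurable h)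
    (hn : ∀ t < 0, h t = 0) (hb : ∀ t ≤ T, |h t| ≤ K) : IntegrableOn h (Iic T) := by
  have h1 : IntegrableOn h (Icc 0 T) := by
    refine Measure.integrableOn_of_bounded (M := K) ?_ hm.aestronglyMeasurable ?_
    · simp
    · refine (ae_restrict_iff' measurableSet_Icc).2 (Eventually.of_forall fun t ht => ?_)
      exact hb t ht.2
  rw [← integrable_indicator_iff measurableSet_Icc] at h1
  rw [← integrable_indicator_iff measurableSet_Iic]
  convert h1 using 1
  ext t
  by_cases ht : t < 0
  · simp [indicator, hn t ht]
  · simp [indicator, not_lt.1 ht]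

/-- The tail of the kernel. -/
noncomputable def tail (g : ℝ → ℝ) (u : ℝ) : ℝ := ∫ w, if 0 ≤ u ∧ u < w then g w else 0

lemma tail_neg (g : ℝ → ℝ) {u : ℝ} (hu : u < 0) : tail g u = 0 := by
  simp [tail, not_le.2 hu]

lemma tail_pos (g : ℝ → ℝ) {u : ℝ} (hu : 0 ≤ u) : tail g u = ∫ w in Ioi u, g w := by
  rw [← integral_indicator measurableSet_Ioi]
  simp [tail, hu, indicator]

lemma tail_nonneg {g : ℝ → ℝ} (h : ∀ t, 0 ≤ g t) (u : ℝ) : 0 ≤ tail g u := by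
  apply integral_nonneg
  intro w
  dsimp only [Pi.zero_apply]
  split_ifs
  · exact h w
  · exact le_rfl

namespace Ren
variable {g f y : ℝ → ℝ} {B c : ℝ}

lemma gi (R : Ren g f y B c) : Integrable g :=
  integrable_of_exp R.hc R.gm R.gn fun t ht => by rw [abs_of_nonneg (R.g0 t)]; exact R.gb t ht

lemma fi (R : Ren g f y B c) : Integrable f :=
  integrable_of_exp R.hc R.fm R.fn fun t ht => by rw [abs_of_nonneg (R.f0 t)]; exact R.fb t ht

lemma gB (R : Ren g f y B c) (t : ℝ) : g t ≤ B := by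
  by_cases ht : t < 0
  · rw [R.gn t ht]; exact R.hB.le
  · refine (R.gb t (not_lt.1 ht)).trans ?_
    have : Real.exp (-c * t) ≤ 1 := by
      rw [Real.exp_le_one_iff]; nlinarith [R.hc, not_lt.1 ht]
    nlinarith [R.hB]

lemma fB (R : Ren g f y B c) (t : ℝ) : f t ≤ B := by
  by_cases ht : t < 0
  · rw [R.fn t ht]; exact R.hB.le
  · refine (R.fb t (not_lt.1 ht)).trans ?_
    have : Real.exp (-c * t) ≤ 1 := by
      rw [Real.exp_le_one_iff]; nlinarith [R.hc, not_lt.1 ht]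
    nlinarith [R.hB]

lemma exp_lim {h : ℝ → ℝ} {B c : ℝ} (hc : 0 < c) (h0 : ∀ t, 0 ≤ h t)
    (hb : ∀ t ≥ 0, h t ≤ B * Real.exp (-c * t)) : Tendsto h atTop (nhds 0) := by
  have h1 : Tendsto (fun t : ℝ => B * Real.exp (-c * t)) atTop (nhds 0) := by
    rw [show (0:ℝ) = B * 0 by simp]
    refine Tendsto.const_mul B (Real.tendsto_exp_atBot.comp ?_)
    exact tendsto_id.const_mul_atTop_of_neg (by linarith)
  refine squeeze_zero' (Eventually.of_forall h0) ?_ h1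
  filter_upwards [eventually_ge_atTop 0] with t ht using hb t ht

lemma glim (R : Ren g f y B c) : Tendsto g atTop (nhds 0) := exp_lim R.hc R.g0 R.gb
lemma flim (R : Ren g f y B c) : Tendsto f atTop (nhds 0) := exp_lim R.hc R.f0 R.fb

lemma sgi (R : Ren g f y B c) : Integrable (fun s => s * g s) := by
  refine integrable_of_exp (B := B * (2 / c)) (c := c / 2) (by linarith [R.hc])
    (measurable_id.mul R.gm) (fun t ht => by simp [R.gn t ht]) fun t ht => ?_
  rw [abs_of_nonneg (mul_nonneg ht (R.g0 t))]
  have h1 := R.gb t ht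
  have h2 : t ≤ (2 / c) * Real.exp (c / 2 * t) := by
    have := Real.add_one_le_exp (c / 2 * t)
    have hc := R.hc
    calc t = (2 / c) * (c / 2 * t) := by field_simp
      _ ≤ _ := by gcongr; linarith
  calc t * g t ≤ ((2 / c) * Real.exp (c / 2 * t)) * (B * Real.exp (-c * t)) := by
        have := R.hc
        gcongr
        exact R.g0 t
    _ = B * (2 / c) * (Real.exp (c / 2 * t) * Real.exp (-c * t)) := by ring
    _ = _ := by rw [← Real.exp_add]; ring_nf

lemma sgpos (R : Ren g f y B c) : 0 < ∫ s, s * g s := by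
  have hnn : ∀ s, 0 ≤ s * g s := fun s => by
    by_cases hs : s < 0
    · simp [R.gn s hs]
    · exact mul_nonneg (not_lt.1 hs) (R.g0 s)
  refine lt_of_le_of_ne (integral_nonneg hnn) fun h => ?_
  have h1 := (integral_eq_zero_iff_of_nonneg hnn R.sgi).1 h.symm
  have h2 : g =ᵐ[volume] 0 := by
    have h0 : ∀ᵐ s : ℝ, s ≠ 0 := by simp [ae_iff]
    filter_upwards [h1, h0] with s hs h0
    simpa [h0] using hs
  have := R.crit
  rw [integral_congr_ae h2] at this
  simp at this

lemma tail_eq (R : Ren g f y B c) {u : ℝ} (hu : 0 ≤ u) : tail g u = 1 - ∫ w in Iic u, g w := by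
  rw [tail_pos g hu, ← R.crit, ← integral_add_compl (measurableSet_Iic (a := u)) R.gi, compl_Iic]
  ring

lemma prod_int (R : Ren g f y B c) :
    Integrable (Function.uncurry fun u w : ℝ => if 0 ≤ u ∧ u < w then g w else 0)
      (volume.prod volume) ∧
    ∀ w, ∫ u : ℝ, (if 0 ≤ u ∧ u < w then g w else 0) = w * g w := by
  have key : ∀ w, (fun u : ℝ => if 0 ≤ u ∧ u < w then g w else 0)
      = (Ico 0 w).indicator fun _ => g w := by
    intro w; ext u; simp [indicator]
  have key2 : ∀ w, ∫ u : ℝ, (if 0 ≤ u ∧ u < w then g w else 0) = w * g w := by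
    intro w
    rw [key, integral_indicator measurableSet_Ico]
    by_cases hw : w < 0
    · simp [R.gn w hw]
    · simp [not_lt.1 hw]
  refine ⟨?_, key2⟩
  have hm : Measurable (Function.uncurry fun u w : ℝ => if 0 ≤ u ∧ u < w then g w else 0) := by
    refine Measurable.ite ?_ (R.gm.comp measurable_snd) measurable_const
    exact (measurableSet_le measurable_const measurable_fst).inter
      (measurableSet_lt measurable_fst measurable_snd)
  rw [integrable_prod_iff' hm.aestronglyMeasurable]
  constructor
  · refine Eventually.of_forall fun w => ?_
    simp only [Function.uncurry]
    rw [key, integrable_indicator_iff measurableSet_Ico]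
    exact integrableOn_const (by simp)
  · refine R.sgi.congr (Eventually.of_forall fun w => ?_)
    dsimp only
    rw [← key2 w]
    congr 1
    ext u
    simp only [Function.uncurry]
    rw [Real.norm_of_nonneg]
    split_ifs
    · exact R.g0 w
    · exact le_rfl

lemma tail_int (R : Ren g f y B c) : Integrable (tail g) := R.prod_int.1.integral_prod_left

lemma tail_integral (R : Ren g f y B c) : ∫ u, tail g u = ∫ s, s * g s := by
  unfold tail
  rw [integral_integral_swap R.prod_int.1]
  simp_rw [R.prod_int.2]

lemma conv_int (R : Ren g f y B c) {h : ℝ → ℝ} (hi : Integrable h) :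
    Integrable (Function.uncurry fun t s : ℝ => g (t - s) * h s) (volume.prod volume) := by
  have := hi.convolution_integrand (ContinuousLinearMap.mul ℝ ℝ) R.gi
  convert this using 1
  ext p
  simp [Function.uncurry, mul_comm]

lemma conv_cut (R : Ren g f y B c) (h : ℝ → ℝ) {t T : ℝ} (ht : t ≤ T) :
    ∫ s, g (t - s) * h s = ∫ s, g (t - s) * (Iic T).indicator h s := by
  congr 1
  ext s
  by_cases hs : s ≤ T
  · simp [indicator, hs]
  · rw [R.gn (t - s) (by linarith)]; simp

/-- conservation law -/
lemma conserve (R : Ren g f y B c) {h : ℝ → ℝ} {T : ℝ} (hi : IntegrableOn h (Iic T)) :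
    IntegrableOn (fun t => ∫ s, g (t - s) * h s) (Iic T) ∧
    (∫ t in Iic T, h t) - ∫ t in Iic T, ∫ s, g (t - s) * h s = ∫ s, h s * tail g (T - s) := by
  have hi' := (integrable_indicator_iff measurableSet_Iic).2 hi
  have hc := R.conv_int hi'
  have hcong : EqOn (fun t => ∫ s, g (t - s) * h s)
      (fun t => ∫ s, g (t - s) * (Iic T).indicator h s) (Iic T) :=
    fun t ht => R.conv_cut h ht
  have hcr : Integrable (Function.uncurry fun t s : ℝ => g (t - s) * (Iic T).indicator h s)
      ((volume.restrict (Iic T)).prod volume) := by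
    refine hc.mono_measure ?_
    have := Measure.prod_restrict (μ := (volume : Measure ℝ)) (ν := (volume : Measure ℝ))
      (Iic T) univ
    rw [Measure.restrict_univ] at this
    rw [this]
    exact Measure.restrict_le_self
  constructor
  · refine IntegrableOn.congr_fun ?_ hcong.symm measurableSet_Iic
    exact hcr.integral_prod_left
  · rw [setIntegral_congr_fun measurableSet_Iic hcong, integral_integral_swap hcr,
      ← integral_indicator measurableSet_Iic]
    have hpr : Integrable fun s => ∫ t in Iic T, g (t - s) * (Iic T).indicator h s :=
      hcr.integral_prod_right
    rw [← integral_sub hi' hpr]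
    congr 1
    ext s
    by_cases hs : s ≤ T
    · rw [R.tail_eq (by linarith), integral_mul_const, indicator_of_mem (by exact hs)]
      have : ∫ t in Iic T, g (t - s) = ∫ w in Iic (T - s), g w := by
        rw [← integral_indicator measurableSet_Iic, ← integral_indicator measurableSet_Iic,
          ← integral_sub_right_eq_self ((Iic (T - s)).indicator fun w => g w) s]
        congr 1
        ext t
        simp [indicator]
      rw [this]; ring
    · rw [tail_neg g (by linarith)]
      simp [indicator, hs]

lemma yi (R : Ren g f y B c) (T : ℝ) : IntegrableOn y (Iic T) := by
  obtain ⟨K, hK⟩ := R.yb T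
  exact integrable_of_bdd R.ym R.yn fun t ht => by rw [abs_of_nonneg (R.y0 t)]; exact hK t ht

lemma cons_y (R : Ren g f y B c) (T : ℝ) :
    ∫ s, y s * tail g (T - s) = ∫ t in Iic T, f t := by
  obtain ⟨h1, h2⟩ := R.conserve (R.yi T)
  rw [← h2, ← integral_sub (R.yi T) h1]
  congr 1
  ext t
  have := R.eqn t
  linarith

end Ren

namespace Ren
variable {g f y : ℝ → ℝ} {B c : ℝ}

lemma tail_le_one (R : Ren g f y B c) (u : ℝ) : tail g u ≤ 1 := by
  by_cases hu : u < 0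
  · rw [tail_neg g hu]; norm_num
  · rw [R.tail_eq (not_lt.1 hu)]
    have : 0 ≤ ∫ w in Iic u, g w := integral_nonneg fun w => R.g0 w
    linarith

lemma tail_lower (R : Ren g f y B c) {u : ℝ} (hu : 0 ≤ u) : 1 - B * u ≤ tail g u := by
  rw [R.tail_eq hu]
  have h1 : ∫ w in Iic u, g w ≤ ∫ w, (Icc 0 u).indicator (fun _ => B) w := by
    rw [← integral_indicator measurableSet_Iic]
    refine integral_mono (R.gi.indicator measurableSet_Iic)
      ((integrable_indicator_iff measurableSet_Icc).2 (integrableOn_const (by simp))) fun w => ?_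
    by_cases hw : w < 0
    · simp [indicator, R.gn w hw, not_le.2 hw]
    · by_cases hwu : w ≤ u
      · simp [indicator, not_lt.1 hw, hwu, R.gB w]
      · simp [indicator, hwu]
  rw [integral_indicator measurableSet_Icc] at h1
  simp [hu] at h1
  linarith

lemma ytail_int (R : Ren g f y B c) (T : ℝ) : Integrable fun s => y s * tail g (T - s) := by
  have h1 := (integrable_indicator_iff measurableSet_Iic).2 (R.yi T)
  have h2 := h1.mul_bdd (c := 1) (R.tail_int.comp_sub_left T).aestronglyMeasurable
    (Eventually.of_forall fun s => by
      rw [Real.norm_of_nonneg (tail_nonneg R.g0 _)]; exact R.tail_le_one _)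
  refine h2.congr (Eventually.of_forall fun s => ?_)
  by_cases hs : s ≤ T
  · simp [indicator, hs]
  · simp [tail_neg g (show T - s < 0 by linarith)]

lemma window (R : Ren g f y B c) (T : ℝ) :
    ∫ s in Ioc (T - 1 / (2 * B)) T, y s ≤ 2 * ∫ t, f t := by
  have hB := R.hB
  calc ∫ s in Ioc (T - 1 / (2 * B)) T, y s
      ≤ ∫ s in Ioc (T - 1 / (2 * B)) T, 2 * (y s * tail g (T - s)) := by
        refine setIntegral_mono_on ((R.yi T).mono_set Ioc_subset_Iic_self)
          ((R.ytail_int T).const_mul 2).integrableOn measurableSet_Ioc fun s hs => ?_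
        have h1 := R.tail_lower (u := T - s) (by linarith [hs.2])
        have h2 : B * (T - s) ≤ 1 / 2 := by
          calc B * (T - s) ≤ B * (1 / (2 * B)) := by gcongr; linarith [hs.1]
            _ = 1 / 2 := by field_simp
        nlinarith [R.y0 s]
    _ ≤ ∫ s, 2 * (y s * tail g (T - s)) := by
        refine setIntegral_le_integral ((R.ytail_int T).const_mul 2)
          (Eventually.of_forall fun s => ?_)
        exact mul_nonneg (by norm_num) (mul_nonneg (R.y0 s) (tail_nonneg R.g0 _))
    _ = 2 * ∫ t in Iic T, f t := by rw [integral_const_mul, R.cons_y]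
    _ ≤ _ := by
        refine mul_le_mul_of_nonneg_left ?_ (by norm_num)
        exact setIntegral_le_integral R.fi (Eventually.of_forall R.f0)

lemma wint (R : Ren g f y B c) (t : ℝ) :
    IntegrableOn (fun s => Real.exp (-c * (t - s)) * y s) (Iic t) := by
  obtain ⟨K, hK⟩ := R.yb t
  refine integrable_of_bdd (K := K) (by have := R.ym; fun_prop)
    (fun s hs => by simp [R.yn s hs]) fun s hs => ?_
  rw [abs_of_nonneg (mul_nonneg (Real.exp_pos _).le (R.y0 s))]
  have : Real.exp (-c * (t - s)) ≤ 1 := by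
    rw [Real.exp_le_one_iff]; nlinarith [R.hc]
  nlinarith [R.y0 s, hK s hs]

lemma wbound (R : Ren g f y B c) :
    ∃ K, ∀ t, ∫ s in Iic t, Real.exp (-c * (t - s)) * y s ≤ K := by
  have hB := R.hB
  have hc := R.hc
  set δ : ℝ := 1 / (2 * B) with hδ
  have hδ0 : 0 < δ := by positivity
  set q := Real.exp (-c * δ) with hq
  have hq1 : q < 1 := by rw [hq, Real.exp_lt_one_iff]; nlinarith
  have hq0 : 0 < q := Real.exp_pos _
  set A := 2 * ∫ t, f t with hA
  have hA0 : 0 ≤ A := mul_nonneg (by norm_num) (integral_nonneg R.f0)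
  have hAq : A + q * (A / (1 - q)) = A / (1 - q) := by
    have : 1 - q ≠ 0 := by linarith
    field_simp; ring
  have key : ∀ n : ℕ, ∀ t < n * δ,
      ∫ s in Iic t, Real.exp (-c * (t - s)) * y s ≤ A / (1 - q) := by
    intro n
    induction n with
    | zero =>
      intro t ht
      have ht : t < 0 := by simpa using ht
      rw [setIntegral_eq_zero_of_forall_eq_zero]
      · exact div_nonneg hA0 (by linarith)
      · intro s hs
        rw [R.yn s (lt_of_le_of_lt hs ht)]; simp
    | succ n ih =>
      intro t ht
      have h1 := ih (t - δ) (by push_cast at ht; linarith)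
      have hu : Iic t = Iic (t - δ) ∪ Ioc (t - δ) t := (Iic_union_Ioc_eq_Iic (by linarith)).symm
      have hW := R.wint t
      have h2 : ∫ s in Iic t, Real.exp (-c * (t - s)) * y s
          = (∫ s in Iic (t - δ), Real.exp (-c * (t - s)) * y s)
            + ∫ s in Ioc (t - δ) t, Real.exp (-c * (t - s)) * y s := by
        conv_lhs => rw [hu]
        rw [setIntegral_union (Iic_disjoint_Ioc le_rfl) measurableSet_Ioc
          (hW.mono_set (Iic_subset_Iic.2 (by linarith))) (hW.mono_set Ioc_subset_Iic_self)]
      have h3 : ∫ s in Iic (t - δ), Real.exp (-c * (t - s)) * y s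
          = q * ∫ s in Iic (t - δ), Real.exp (-c * (t - δ - s)) * y s := by
        rw [← integral_const_mul]
        congr 1
        ext s
        rw [hq, ← mul_assoc, ← Real.exp_add]
        ring_nf
      have h4 : ∫ s in Ioc (t - δ) t, Real.exp (-c * (t - s)) * y s ≤ A := by
        refine le_trans ?_ (R.window t)
        refine setIntegral_mono_on (hW.mono_set Ioc_subset_Iic_self)
          ((R.yi t).mono_set Ioc_subset_Iic_self) measurableSet_Ioc fun s hs => ?_
        have : Real.exp (-c * (t - s)) ≤ 1 := by
          rw [Real.exp_le_one_iff]; nlinarith [hs.2]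
        nlinarith [R.y0 s]
      have h5 := mul_le_mul_of_nonneg_left h1 hq0.le
      rw [h2, h3, ← hAq]
      linarith
  refine ⟨A / (1 - q), fun t => ?_⟩
  obtain ⟨n, hn⟩ := exists_nat_gt (t / δ)
  exact key n t (by rwa [div_lt_iff₀ hδ0] at hn)

lemma ybound (R : Ren g f y B c) : ∃ K, 0 < K ∧ ∀ t, y t ≤ K := by
  obtain ⟨W, hW⟩ := R.wbound
  have hB := R.hB
  refine ⟨max 1 (B + B * W), by positivity, fun t => le_trans ?_ (le_max_right _ _)⟩
  rw [R.eqn t]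
  refine add_le_add (R.fB t) ?_
  rw [← setIntegral_eq_integral_of_forall_compl_eq_zero (s := Iic t)]
  · calc ∫ s in Iic t, g (t - s) * y s
        ≤ ∫ s in Iic t, B * (Real.exp (-c * (t - s)) * y s) := by
          obtain ⟨K, hK⟩ := R.yb t
          refine setIntegral_mono_on ?_ ((R.wint t).const_mul B) measurableSet_Iic fun s hs => ?_
          · refine integrable_of_bdd (K := B * K) ?_
              (fun s hs => by simp [R.yn s hs]) fun s hs => ?_
            · have := R.ym
              have := R.gm
              fun_prop
            · rw [abs_of_nonneg (mul_nonneg (R.g0 _) (R.y0 s))]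
              exact mul_le_mul (R.gB _) (hK s hs) (R.y0 s) R.hB.le
          · rw [← mul_assoc]
            exact mul_le_mul_of_nonneg_right (R.gb (t - s) (sub_nonneg.2 hs)) (R.y0 s)
      _ = B * ∫ s in Iic t, Real.exp (-c * (t - s)) * y s := integral_const_mul _ _
      _ ≤ B * W := by gcongr; exact hW t
  · intro s hs
    have hs : t < s := by simpa using hs
    rw [R.gn (t - s) (by linarith)]; simp

lemma conv_swap (g h : ℝ → ℝ) (t : ℝ) : ∫ s, g (t - s) * h s = ∫ u, g u * h (t - u) := by
  rw [← integral_sub_left_eq_self (fun u => g u * h (t - u)) volume t]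
  simp

lemma gh_int (R : Ren g f y B c) {h : ℝ → ℝ} {K : ℝ} (hm : Measurable h) (hb : ∀ u, |h u| ≤ K) :
    Integrable fun u => g u * h u :=
  R.gi.mul_bdd (c := K) hm.aestronglyMeasurable (Eventually.of_forall hb)

lemma gh2_int (R : Ren g f y B c) {h : ℝ → ℝ} {K : ℝ} (hm : Measurable h) (hb : ∀ u, |h u| ≤ K) :
    Integrable fun u => g u * h u ^ 2 :=
  R.gh_int (K := K ^ 2) (hm.pow_const 2) fun u => by
    rw [abs_pow]; exact pow_le_pow_left₀ (abs_nonneg _) (hb u) 2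

lemma variance (R : Ren g f y B c) {h : ℝ → ℝ} {K : ℝ} (hm : Measurable h)
    (hb : ∀ u, |h u| ≤ K) (a : ℝ) :
    ∫ u, g u * (h u - a) ^ 2 = (∫ u, g u * h u ^ 2) - 2 * a * (∫ u, g u * h u) + a ^ 2 := by
  have h1 := R.gh_int hm hb
  have h2 := R.gh2_int hm hb
  have : (fun u => g u * (h u - a) ^ 2)
      = fun u => (g u * h u ^ 2 - 2 * a * (g u * h u)) + a ^ 2 * g u := by
    ext u; ring
  have h3 : Integrable fun u => g u * h u ^ 2 - 2 * a * (g u * h u) := h2.sub (h1.const_mul _)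
  rw [this, integral_add h3 (R.gi.const_mul _),
    integral_sub h2 (h1.const_mul _), integral_const_mul, integral_const_mul, R.crit]
  ring

/-- energy estimate -/
lemma energy (R : Ren g f y B c) :
    Integrable fun t => ∫ u, g u * (y (t - u) - y t) ^ 2 := by
  obtain ⟨K, hK0, hK⟩ := R.ybound
  have hyK : ∀ t, |y t| ≤ K := fun t => by rw [abs_of_nonneg (R.y0 t)]; exact hK t
  have hD : ∀ t, ∫ u, g u * (y (t - u) - y t) ^ 2
      = 2 * (y t * f t) - (y t ^ 2 - ∫ s, g (t - s) * y s ^ 2) := by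
    intro t
    have := R.ym
    rw [R.variance (h := fun u => y (t - u)) (K := K) (by fun_prop) (fun u => hyK _) (y t),
      ← conv_swap g y t, ← conv_swap g (fun s => y s ^ 2) t]
    have := R.eqn t
    have h : ∫ s, g (t - s) * y s = y t - f t := by linarith
    rw [h]; ring
  have hy2 : ∀ T, IntegrableOn (fun t => y t ^ 2) (Iic T) := fun T =>
    integrable_of_bdd (K := K ^ 2) (R.ym.pow_const 2) (fun s hs => by simp [R.yn s hs])
      fun s _ => by rw [abs_pow]; exact pow_le_pow_left₀ (abs_nonneg _) (hyK s) 2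
  have hyf : Integrable fun t => y t * f t :=
    R.fi.bdd_mul (c := K) R.ym.aestronglyMeasurable (Eventually.of_forall hyK)
  refine (aecover_Iic (b := fun T : ℝ => T) tendsto_id).integrable_of_integral_bounded_of_nonneg_ae
    (2 * ∫ t, y t * f t) (fun T => ?_) (Eventually.of_forall fun t => integral_nonneg fun u =>
      mul_nonneg (R.g0 u) (sq_nonneg _)) (Eventually.of_forall fun T => ?_)
  · simp_rw [hD]
    exact (hyf.const_mul 2).integrableOn.sub ((hy2 T).sub (R.conserve (hy2 T)).1)
  · simp_rw [hD]
    obtain ⟨h1, h2⟩ := R.conserve (hy2 T)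
    have h12 : IntegrableOn (fun t => y t ^ 2 - ∫ s, g (t - s) * y s ^ 2) (Iic T) :=
      (hy2 T).sub h1
    rw [integral_sub (hyf.const_mul 2).integrableOn h12,
      integral_sub (hy2 T) h1, h2, integral_const_mul]
    have h3 : 0 ≤ ∫ s, y s ^ 2 * tail g (T - s) :=
      integral_nonneg fun s => mul_nonneg (sq_nonneg _) (tail_nonneg R.g0 _)
    have h4 := setIntegral_le_integral (s := Iic T) hyf
      (Eventually.of_forall fun t => mul_nonneg (R.y0 t) (R.f0 t))
    linarith

lemma ae_shift (R : Ren g f y B c) :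
    ∀ᵐ u, 0 < g u → Integrable fun t => (y (t - u) - y t) ^ 2 := by
  obtain ⟨K, hK0, hK⟩ := R.ybound
  have hyK : ∀ t, |y t| ≤ K := fun t => by rw [abs_of_nonneg (R.y0 t)]; exact hK t
  have hym := R.ym
  have hgm := R.gm
  have hm : Measurable (fun p : ℝ × ℝ => g p.2 * (y (p.1 - p.2) - y p.1) ^ 2) := by fun_prop
  have hint : Integrable (fun p : ℝ × ℝ => g p.2 * (y (p.1 - p.2) - y p.1) ^ 2)
      (volume.prod volume) := by
    rw [integrable_prod_iff hm.aestronglyMeasurable]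
    constructor
    · refine Eventually.of_forall fun t => ?_
      refine R.gh2_int (h := fun u => y (t - u) - y t) (K := K + K) (by fun_prop) fun u => ?_
      exact (abs_sub _ _).trans (add_le_add (hyK _) (hyK _))
    · refine R.energy.congr (Eventually.of_forall fun t => ?_)
      dsimp only
      congr 1
      ext u
      rw [Real.norm_of_nonneg (mul_nonneg (R.g0 u) (sq_nonneg _))]
  filter_upwards [hint.prod_left_ae] with u hu hgu
  refine (hu.const_mul (g u)⁻¹).congr (Eventually.of_forall fun t => ?_)
  dsimp only
  field_simp

lemma shift_lim (R : Ren g f y B c) {u : ℝ} (hu : Integrable fun t => (y (t - u) - y t) ^ 2) :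
    Tendsto (fun t => y (t - u) - y t) atTop (nhds 0) := by
  obtain ⟨K, hK0, hK⟩ := R.ybound
  have hyK : ∀ t, |y t| ≤ K := fun t => by rw [abs_of_nonneg (R.y0 t)]; exact hK t
  have hym := R.ym
  set d : ℝ → ℝ := fun t => y (t - u) - y t with hd
  have hdm : Measurable d := by fun_prop
  have hdK : ∀ t, |d t| ≤ K + K := fun t => (abs_sub _ _).trans (add_le_add (hyK _) (hyK _))
  have h1 : Tendsto (fun t => ∫ w, g (t - w) * d w ^ 2) atTop (nhds 0) := by
    have : Tendsto (fun t => ∫ w, g (t - w) * d w ^ 2) atTop (nhds (∫ w : ℝ, (0:ℝ))) := by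
      refine tendsto_integral_filter_of_dominated_convergence (fun w => B * d w ^ 2) ?_ ?_
        (hu.const_mul B) ?_
      · refine Eventually.of_forall fun t => ?_
        have := R.gm
        exact Measurable.aestronglyMeasurable (by fun_prop)
      · refine Eventually.of_forall fun t => Eventually.of_forall fun w => ?_
        rw [Real.norm_of_nonneg (mul_nonneg (R.g0 _) (sq_nonneg _))]
        exact mul_le_mul_of_nonneg_right (R.gB _) (sq_nonneg _)
      · refine Eventually.of_forall fun w => ?_
        rw [show (0:ℝ) = 0 * d w ^ 2 by simp]
        refine Tendsto.mul_const _ (R.glim.comp ?_)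
        exact tendsto_atTop_add_const_right _ (-w) tendsto_id
    simpa using this
  have h2 : Tendsto (fun t => ∫ w, g (t - w) * d w) atTop (nhds 0) := by
    have hs : Tendsto (fun t => Real.sqrt (∫ w, g (t - w) * d w ^ 2)) atTop (nhds 0) := by
      simpa using h1.sqrt
    refine squeeze_zero_norm (fun t => ?_) hs
    rw [Real.norm_eq_abs]
    apply Real.abs_le_sqrt
    rw [conv_swap g d t, conv_swap g (fun s => d s ^ 2) t]
    have hv := R.variance (h := fun w => d (t - w)) (K := K + K) (by fun_prop)
      (fun w => hdK _) (∫ w, g w * d (t - w))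
    have h0 : 0 ≤ ∫ w, g w * (d (t - w) - ∫ w, g w * d (t - w)) ^ 2 :=
      integral_nonneg fun w => mul_nonneg (R.g0 _) (sq_nonneg _)
    nlinarith
  have h3 : ∀ t, d t = (f (t - u) - f t) + ∫ w, g (t - w) * d w := by
    intro t
    rw [conv_swap g d t]
    have e1 := R.eqn t
    have e2 := R.eqn (t - u)
    rw [conv_swap] at e1 e2
    have e3 : ∫ w, g w * d (t - w) = (∫ w, g w * y (t - u - w)) - ∫ w, g w * y (t - w) := by
      rw [← integral_sub (R.gh_int (K := K) (by fun_prop) fun w => hyK _)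
        (R.gh_int (K := K) (by fun_prop) fun w => hyK _)]
      congr 1
      ext w
      simp only [hd]
      rw [show t - w - u = t - u - w by ring]; ring
    rw [e3]
    simp only [hd]
    linarith
  have h4 : Tendsto (fun t => (f (t - u) - f t) + ∫ w, g (t - w) * d w) atTop (nhds 0) := by
    have := ((R.flim.comp (tendsto_atTop_add_const_right _ (-u) tendsto_id)).sub R.flim).add h2
    simpa [Function.comp_def, ← sub_eq_add_neg] using this
  exact h4.congr fun t => (h3 t).symm

/-- The shifts along which `y` is asymptotically invariant. -/
def shifts (y : ℝ → ℝ) : AddSubgroup ℝ where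
  carrier := {u | Tendsto (fun t => y (t - u) - y t) atTop (nhds 0)}
  zero_mem' := by simp
  add_mem' := by
    intro a b ha hb
    have h := (ha.comp (tendsto_atTop_add_const_right _ (-b) tendsto_id)).add hb
    simp only [mem_ofPred_eq]
    simp only [add_zero] at h
    refine h.congr fun t => ?_
    simp only [Function.comp, id, ← sub_eq_add_neg]
    rw [show t - (a + b) = t - b - a by ring]; ring
  neg_mem' := by
    intro a ha
    have h := (ha.comp (tendsto_atTop_add_const_right _ a tendsto_id)).neg
    simp only [mem_ofPred_eq]
    simp only [neg_zero] at h
    refine h.congr fun t => ?_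
    simp only [Function.comp, id]
    rw [show t - -a = t + a by ring, add_sub_cancel_right]; ring

lemma all_shift (R : Ren g f y B c) (u : ℝ) :
    Tendsto (fun t => y (t - u) - y t) atTop (nhds 0) := by
  suffices h : shifts y = ⊤ by
    have : u ∈ shifts y := by rw [h]; trivial
    exact this
  have hN := R.ae_shift
  rw [ae_iff] at hN
  obtain ⟨N, hsub, hNm, hN0⟩ := exists_measurable_superset_of_null hN
  set E : Set ℝ := {u | 0 < g u} \ N with hE
  have hEm : MeasurableSet E := (measurableSet_lt measurable_const R.gm).diff hNm
  have hEpos : 0 < volume E := by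
    rw [hE, measure_sdiff_null hN0]
    refine pos_iff_ne_zero.2 fun h0 => ?_
    have h2 : g =ᵐ[volume] 0 := by
      have : ∀ᵐ u, ¬ (0 < g u) := by rw [ae_iff]; simpa using h0
      filter_upwards [this] with s hs
      exact le_antisymm (not_lt.1 hs) (R.g0 s)
    have := R.crit
    rw [integral_congr_ae h2] at this
    simp at this
  have hEs : ∀ u ∈ E, u ∈ shifts y := by
    intro u hu
    apply R.shift_lim
    by_contra hcon
    exact hu.2 (hsub (by simpa using ⟨hu.1, hcon⟩))
  have hst := Measure.sub_mem_nhds_zero_of_addHaar_pos volume E hEm hEpos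
  have hmem : (shifts y : Set ℝ) ∈ nhds (0:ℝ) := by
    refine mem_of_superset hst ?_
    rintro _ ⟨a, ha, b, hb, rfl⟩
    exact sub_mem (hEs a ha) (hEs b hb)
  have hopen := AddSubgroup.isOpen_of_mem_nhds _ hmem
  have hcl : IsClopen (shifts y : Set ℝ) := ⟨AddSubgroup.isClosed_of_isOpen _ hopen, hopen⟩
  have := hcl.eq_univ ⟨0, zero_mem _⟩
  exact SetLike.coe_injective (by simpa using this)

/-- the renewal theorem -/
theorem limit (R : Ren g f y B c) :
    Tendsto y atTop (nhds ((∫ t, f t) / ∫ s, s * g s)) := by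
  obtain ⟨K, hK0, hK⟩ := R.ybound
  have hyK : ∀ t, |y t| ≤ K := fun t => by rw [abs_of_nonneg (R.y0 t)]; exact hK t
  have hym := R.ym
  have h1 : Tendsto (fun t => ∫ u, tail g u * (y (t - u) - y t)) atTop (nhds 0) := by
    have : Tendsto (fun t => ∫ u, tail g u * (y (t - u) - y t)) atTop
        (nhds (∫ u : ℝ, (0:ℝ))) := by
      refine tendsto_integral_filter_of_dominated_convergence (fun u => tail g u * (K + K)) ?_ ?_
        (R.tail_int.mul_const _) ?_
      · refine Eventually.of_forall fun t => R.tail_int.aestronglyMeasurable.mul ?_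
        exact Measurable.aestronglyMeasurable (by fun_prop)
      · refine Eventually.of_forall fun t => Eventually.of_forall fun u => ?_
        rw [norm_mul, Real.norm_of_nonneg (tail_nonneg R.g0 _)]
        refine mul_le_mul_of_nonneg_left ?_ (tail_nonneg R.g0 _)
        exact (abs_sub _ _).trans (add_le_add (hyK _) (hyK _))
      · refine Eventually.of_forall fun u => ?_
        simpa using (R.all_shift u).const_mul (tail g u)
    simpa using this
  have h2 : Tendsto (fun t => ∫ s in Iic t, f s) atTop (nhds (∫ s, f s)) :=
    (aecover_Iic (b := fun T : ℝ => T) tendsto_id).integral_tendsto_of_countably_generated R.fi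
  have hmpos := R.sgpos
  have h3 : ∀ t, y t = ((∫ s in Iic t, f s) - ∫ u, tail g u * (y (t - u) - y t))
      / ∫ s, s * g s := by
    intro t
    have e : ∫ u, tail g u * (y (t - u) - y t)
        = (∫ s in Iic t, f s) - (∫ s, s * g s) * y t := by
      have i1 : Integrable fun u => tail g u * y (t - u) :=
        R.tail_int.mul_bdd (c := K) (Measurable.aestronglyMeasurable (by fun_prop))
          (Eventually.of_forall fun u => hyK _)
      simp_rw [mul_sub]
      rw [integral_sub i1 (R.tail_int.mul_const _), integral_mul_const, R.tail_integral,
        ← R.cons_y t, ← conv_swap (tail g) y t]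
      simp_rw [mul_comm]
    rw [e, eq_div_iff hmpos.ne']
    ring
  have h4 := (h2.sub h1).div_const (∫ s, s * g s)
  rw [sub_zero] at h4
  exact h4.congr fun t => (h3 t).symm

/-- convolution with an integrable kernel -/
theorem conv_limit (R : Ren g f y B c) {k : ℝ → ℝ} (hk : Integrable k) :
    Tendsto (fun t => ∫ s, k (t - s) * y s) atTop
      (nhds ((∫ t, k t) * ((∫ t, f t) / ∫ s, s * g s))) := by
  obtain ⟨K, hK0, hK⟩ := R.ybound
  have hyK : ∀ t, |y t| ≤ K := fun t => by rw [abs_of_nonneg (R.y0 t)]; exact hK t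
  have hym := R.ym
  simp_rw [conv_swap k y]
  rw [← integral_mul_const]
  refine tendsto_integral_filter_of_dominated_convergence (fun u => |k u| * K) ?_ ?_
    (hk.abs.mul_const _) ?_
  · refine Eventually.of_forall fun t => hk.aestronglyMeasurable.mul ?_
    exact Measurable.aestronglyMeasurable (by fun_prop)
  · refine Eventually.of_forall fun t => Eventually.of_forall fun u => ?_
    rw [norm_mul]
    exact mul_le_mul_of_nonneg_left (hyK _) (norm_nonneg _)
  · refine Eventually.of_forall fun u => ?_
    exact (R.limit.comp (tendsto_atTop_add_const_right _ (-u) tendsto_id)).const_mul (k u)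

end Ren

lemma Gν_meas (α : ℝ) (ν : MeasureTheory.SignedMeasure ℝ) {ψ : ℝ → ℝ} (hψ : Measurable ψ) :
    Measurable (Gν α ν ψ) := by
  have h : StronglyMeasurable (Function.uncurry fun t u : ℝ => ψ (t + u)) :=
    (hψ.comp (measurable_fst.add measurable_snd)).stronglyMeasurable
  exact (h.integral_prod_right.sub h.integral_prod_right).measurable

lemma Gν_bound (α : ℝ) (ν : MeasureTheory.SignedMeasure ℝ) {ψ : ℝ → ℝ} {A γ : ℝ}
    (hA : 0 ≤ A) (hγ : 0 < γ) (hb : ∀ s ≥ -α, |ψ s| ≤ A * Real.exp (-γ * s)) :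
    ∃ B, 0 ≤ B ∧ ∀ t ≥ 0, (Gν α ν ψ t) ^ 2 ≤ B * Real.exp (-(2 * γ) * t) := by
  set p := ν.toJordanDecomposition.posPart.real (Icc (-α) 0)
  set n := ν.toJordanDecomposition.negPart.real (Icc (-α) 0)
  have hp : 0 ≤ p := measureReal_nonneg
  have hn : 0 ≤ n := measureReal_nonneg
  refine ⟨(A * Real.exp (γ * α) * (p + n)) ^ 2, sq_nonneg _, fun t ht => ?_⟩
  have hpt : ∀ u ∈ Icc (-α) 0, ‖ψ (t + u)‖ ≤ A * Real.exp (γ * α) * Real.exp (-γ * t) := by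
    intro u hu
    refine (hb (t + u) (by linarith [hu.1])).trans ?_
    rw [mul_assoc, ← Real.exp_add]
    gcongr
    nlinarith [hu.1]
  have h1 := norm_setIntegral_le_of_norm_le_const (μ := ν.toJordanDecomposition.posPart)
    (measure_lt_top _ _) hpt
  have h2 := norm_setIntegral_le_of_norm_le_const (μ := ν.toJordanDecomposition.negPart)
    (measure_lt_top _ _) hpt
  have h3 : |Gν α ν ψ t| ≤ A * Real.exp (γ * α) * (p + n) * Real.exp (-γ * t) := by
    refine (norm_sub_le (E := ℝ) _ _).trans ?_
    refine (add_le_add h1 h2).trans (le_of_eq ?_)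
    ring
  rw [← sq_abs]
  calc |Gν α ν ψ t| ^ 2 ≤ (A * Real.exp (γ * α) * (p + n) * Real.exp (-γ * t)) ^ 2 := by gcongr
    _ = (A * Real.exp (γ * α) * (p + n)) ^ 2 * (Real.exp (-γ * t) * Real.exp (-γ * t)) := by ring
    _ = _ := by rw [← Real.exp_add]; ring_nf

lemma conv_interval (k y : ℝ → ℝ) {t : ℝ} (ht : 0 ≤ t) :
    ∫ s in (0:ℝ)..t, k (t - s) * y s
      = ∫ s, (Ici 0).indicator k (t - s) * (Ici 0).indicator y s := by
  rw [intervalIntegral.integral_of_le ht, ← integral_Icc_eq_integral_Ioc,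
    ← integral_indicator measurableSet_Icc]
  congr 1
  ext s
  by_cases h1 : 0 ≤ s <;> by_cases h2 : s ≤ t <;> simp [indicator, h1, h2]

lemma integral_ind (k : ℝ → ℝ) : ∫ s, (Ici 0).indicator k s = ∫ s in Ioi (0:ℝ), k s := by
  rw [integral_indicator measurableSet_Ici, integral_Ici_eq_integral_Ioi]

/-- Deterministic core of Theorem 3.2(b): critical case. -/
theorem stmt1 (α : ℝ) (hα : 0 ≤ α) (ν : MeasureTheory.SignedMeasure ℝ)
    (C γ : ℝ) (hC : 0 < C) (hγ : 0 < γ)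
    (r : ℝ → ℝ) (hrmeas : Measurable r) (hrneg : ∀ u < (0:ℝ), r u = 0)
    (hrdecay : ∀ t ≥ (0:ℝ), |r t| ≤ C * Real.exp (-γ * t))
    (x : ℝ → ℝ) (hxcont : Continuous x)
    (hxdecay : ∀ t ≥ (0:ℝ), |x t| ≤ C * Real.exp (-γ * t))
    (f g : ℝ → ℝ)
    (hf : ∀ t ≥ (0:ℝ), f t = (Gν α ν x t) ^ 2)
    (hg : ∀ t ≥ (0:ℝ), g t = (Gν α ν r t) ^ 2)
    (y : ℝ → ℝ) (hymeas : Measurable y) (hynn : ∀ t ≥ (0:ℝ), 0 ≤ y t)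
    (hybdd : ∀ T : ℝ, ∃ K : ℝ, ∀ t ∈ Set.Icc (0:ℝ) T, y t ≤ K)
    (hren : ∀ t ≥ (0:ℝ), y t = f t + ∫ s in (0:ℝ)..t, g (t - s) * y s)
    (M : ℝ → ℝ)
    (hM : ∀ t ≥ (0:ℝ), M t = (x t) ^ 2 + ∫ s in (0:ℝ)..t, (r (t - s)) ^ 2 * y s)
    (hcritical : (∫ s in Set.Ioi (0:ℝ), g s) = 1) :
    MeasureTheory.IntegrableOn (fun s => s * g s) (Set.Ioi 0) ∧
    0 < (∫ s in Set.Ioi (0:ℝ), s * g s) ∧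
    Tendsto M atTop (nhds
      ((∫ s in Set.Ioi (0:ℝ), f s) * (∫ s in Set.Ioi (0:ℝ), (r s) ^ 2)
        / (∫ s in Set.Ioi (0:ℝ), s * g s))) := by

  obtain ⟨A, hA⟩ : ∃ A, ∀ s ∈ Icc (-α) 0, |x s| ≤ A := by
    obtain ⟨A, hA⟩ := isCompact_Icc.exists_bound_of_continuousOn
      (hxcont.continuousOn (s := Icc (-α) 0))
    exact ⟨A, hA⟩
  obtain ⟨B1, hB1, hgb⟩ := Gν_bound α ν (ψ := r) hC.le hγ (fun s _ => by
    by_cases hs : s < 0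
    · rw [hrneg s hs]; simp; positivity
    · exact hrdecay s (not_lt.1 hs))
  obtain ⟨B2, hB2, hfb⟩ := Gν_bound α ν (ψ := x) (A := max C A) (le_max_of_le_left hC.le) hγ
    (fun s hsα => by
      by_cases hs : s < 0
      · have h1 : 1 ≤ Real.exp (-γ * s) := Real.one_le_exp (by nlinarith)
        calc |x s| ≤ max C A := (hA s ⟨hsα, hs.le⟩).trans (le_max_right _ _)
          _ ≤ _ := le_mul_of_one_le_right (le_max_of_le_left hC.le) h1
      · refine (hxdecay s (not_lt.1 hs)).trans ?_
        gcongr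
        exact le_max_left _ _)
  have hgm : Measurable ((Ici (0:ℝ)).indicator g) := by
    have : (Ici (0:ℝ)).indicator g = (Ici (0:ℝ)).indicator fun t => (Gν α ν r t) ^ 2 :=
      indicator_congr fun t ht => hg t ht
    rw [this]
    exact ((Gν_meas α ν hrmeas).pow_const 2).indicator measurableSet_Ici
  have hfm : Measurable ((Ici (0:ℝ)).indicator f) := by
    have : (Ici (0:ℝ)).indicator f = (Ici (0:ℝ)).indicator fun t => (Gν α ν x t) ^ 2 :=
      indicator_congr fun t ht => hf t ht
    rw [this]
    exact ((Gν_meas α ν hxcont.measurable).pow_const 2).indicator measurableSet_Ici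
  have hneg : ∀ h : ℝ → ℝ, ∀ t < 0, (Ici (0:ℝ)).indicator h t = 0 := fun h t ht => by
    simp [indicator, ht]
  have hpos : ∀ h : ℝ → ℝ, ∀ t ≥ 0, (Ici (0:ℝ)).indicator h t = h t := fun h t ht => by
    simp [indicator, ht]
  have R : Ren ((Ici (0:ℝ)).indicator g) ((Ici (0:ℝ)).indicator f) ((Ici (0:ℝ)).indicator y)
      (B1 + B2 + 1) (2 * γ) :=
    { hB := by positivity
      hc := by positivity
      gm := hgm
      fm := hfm
      ym := hymeas.indicator measurableSet_Ici
      g0 := fun t => indicator_nonneg (fun t ht => by rw [hg t ht]; positivity) t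
      f0 := fun t => indicator_nonneg (fun t ht => by rw [hf t ht]; positivity) t
      y0 := fun t => indicator_nonneg (fun t ht => hynn t ht) t
      gn := hneg g
      fn := hneg f
      yn := hneg y
      gb := fun t ht => by
        rw [hpos g t ht, hg t ht]
        refine (hgb t ht).trans ?_
        gcongr
        linarith
      fb := fun t ht => by
        rw [hpos f t ht, hf t ht]
        refine (hfb t ht).trans ?_
        gcongr
        linarith
      yb := fun T => by
        obtain ⟨K, hK⟩ := hybdd T
        refine ⟨max K 0, fun t ht => ?_⟩
        by_cases h : t < 0
        · rw [hneg y t h]; exact le_max_right _ _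
        · rw [hpos y t (not_lt.1 h)]
          exact (hK t ⟨not_lt.1 h, ht⟩).trans (le_max_left _ _)
      eqn := fun t => by
        by_cases h : t < 0
        · rw [hneg y t h, hneg f t h]
          have : ∀ s, (Ici (0:ℝ)).indicator g (t - s) * (Ici (0:ℝ)).indicator y s = 0 := by
            intro s
            by_cases hs : s < 0
            · rw [hneg y s hs, mul_zero]
            · rw [hneg g (t - s) (by linarith), zero_mul]
          simp [this]
        · have h := not_lt.1 h
          rw [hpos y t h, hpos f t h, hren t h, conv_interval g y h]
      crit := by rw [integral_ind, hcritical] }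
  have hmul : (fun s => s * (Ici (0:ℝ)).indicator g s)
      = (Ici (0:ℝ)).indicator fun s => s * g s := by
    ext s; by_cases hs : 0 ≤ s <;> simp [indicator, hs]
  have hm : ∫ s, s * (Ici (0:ℝ)).indicator g s = ∫ s in Ioi (0:ℝ), s * g s := by
    rw [hmul, integral_ind]
  have hsg := R.sgi
  have hsp := R.sgpos
  rw [hm] at hsp
  rw [hmul, integrable_indicator_iff measurableSet_Ici, integrableOn_Ici_iff_integrableOn_Ioi]
    at hsg
  refine ⟨hsg, hsp, ?_⟩
  have hk : Integrable ((Ici (0:ℝ)).indicator fun s => r s ^ 2) := by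
    refine integrable_of_exp (B := C ^ 2) (c := 2 * γ) (by positivity)
      ((hrmeas.pow_const 2).indicator measurableSet_Ici) (hneg _) fun t ht => ?_
    rw [hpos _ t ht, abs_pow]
    calc |r t| ^ 2 ≤ (C * Real.exp (-γ * t)) ^ 2 := by gcongr; exact hrdecay t ht
      _ = C ^ 2 * (Real.exp (-γ * t) * Real.exp (-γ * t)) := by ring
      _ = _ := by rw [← Real.exp_add]; ring_nf
  have hlim := R.conv_limit hk
  rw [hm, integral_ind, integral_ind] at hlim
  have hx2 : Tendsto (fun t => x t ^ 2) atTop (nhds 0) := by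
    refine Ren.exp_lim (B := C ^ 2) (c := 2 * γ) (by positivity) (fun t => sq_nonneg _)
      fun t ht => ?_
    rw [← sq_abs]
    calc |x t| ^ 2 ≤ (C * Real.exp (-γ * t)) ^ 2 := by gcongr; exact hxdecay t ht
      _ = C ^ 2 * (Real.exp (-γ * t) * Real.exp (-γ * t)) := by ring
      _ = _ := by rw [← Real.exp_add]; ring_nf
  have hfin := hx2.add hlim
  rw [zero_add] at hfin
  have hval : (∫ s in Ioi (0:ℝ), f s) * (∫ s in Ioi (0:ℝ), r s ^ 2) / (∫ s in Ioi (0:ℝ), s * g s)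
      = (∫ s in Ioi (0:ℝ), r s ^ 2) * ((∫ s in Ioi (0:ℝ), f s) / ∫ s in Ioi (0:ℝ), s * g s) := by
    ring
  rw [hval]
  refine hfin.congr' ?_
  filter_upwards [eventually_ge_atTop 0] with t ht
  rw [hM t ht, conv_interval (fun s => r s ^ 2) y ht]
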